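/- A basis (eₙ) is tight by support if and only if no two block subspaces with disjoint supports are isomorphic (equivalently, for all disjointly supported block sequences (xₙ) and (yₙ) of (eₙ), the spaces [xₙ] and [yₙ] are not isomorphic), assuming (eₙ) is unconditional. In particular, if some block subspace [xₙ] of an unconditional basis (eₙ) embeds into [eᵢ : i ∉ ⋃ₙ supp xₙ], then (eₙ) is not tight by support. -/

import Mathlib

open scoped BigOperators Classical

noncomputable section

section Prelude

variable {X : Type*} [NormedAddCommGroup X] [NormedSpace ℝ X]

/-- The vector with finitely supported coefficients `c` with respect to the sequence `e`. -/
def vecOf (e : ℕ → X) (c : ℕ →₀ ℝ) : X := c.sum fun n a => a • e n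

/-- `c < d` : the supports of `c` and `d` are successive. -/
def FsuppLt (c d : ℕ →₀ ℝ) : Prop := ∀ a ∈ c.support, ∀ b ∈ d.support, a < b

/-- The Gowers–Maurey function `f(n) = log₂(n+1)`. -/
def flog (n : ℕ) : ℝ := Real.logb 2 ((n : ℝ) + 1)

/-- Support of a functional with respect to the basis `e` (via biorthogonal functionals). -/
def fsupp (e : ℕ → X) (f : X →L[ℝ] ℝ) : Set ℕ := {n | f (e n) ≠ 0}

/-- Bimonotonicity of the basis `e`, expressed on finitely supported vectors:
projections onto intervals are contractive. -/
def Bimonotone (e : ℕ → X) : Prop :=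
  ∀ (c : ℕ →₀ ℝ) (a b : ℕ), ‖vecOf e (c.filter fun n => n ∈ Finset.Icc a b)‖ ≤ ‖vecOf e c‖

/-- Lower `f`-estimate for a general function `f`. -/
def LowerEst (e : ℕ → X) (f : ℝ → ℝ) : Prop :=
  ∀ (n : ℕ) (c : Fin n → ℕ →₀ ℝ), (∀ i j : Fin n, i < j → FsuppLt (c i) (c j)) →
    (1 / f (n : ℝ)) * ∑ i, ‖vecOf e (c i)‖ ≤ ‖∑ i, vecOf e (c i)‖

/-- Lower `f`-estimate with `f(n) = log₂(n+1)`. -/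
def LowerFEst (e : ℕ → X) : Prop :=
  ∀ (n : ℕ) (c : Fin n → ℕ →₀ ℝ), (∀ i j : Fin n, i < j → FsuppLt (c i) (c j)) →
    (1 / flog n) * ∑ i, ‖vecOf e (c i)‖ ≤ ‖∑ i, vecOf e (c i)‖

/-- `Y` embeds isomorphically into `Z` (linear isomorphism onto its image). -/
def Embeds (Y Z : Type*) [NormedAddCommGroup Y] [NormedSpace ℝ Y]
    [NormedAddCommGroup Z] [NormedSpace ℝ Z] : Prop :=
  ∃ T : Y →L[ℝ] Z, ∃ c : ℝ, 0 < c ∧ ∀ y, c * ‖y‖ ≤ ‖T y‖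

/-- `Y` embeds into `Z` with constant `K` (i.e. `‖T‖ ⬝ ‖T⁻¹‖ ≤ K` after normalisation). -/
def EmbedsWithConst (K : ℝ) (Y Z : Type*) [NormedAddCommGroup Y] [NormedSpace ℝ Y]
    [NormedAddCommGroup Z] [NormedSpace ℝ Z] : Prop :=
  ∃ T : Y →L[ℝ] Z, ∀ y, ‖y‖ ≤ ‖T y‖ ∧ ‖T y‖ ≤ K * ‖y‖

/-- The closed span `[eₙ : n ∉ S]`. -/
def spanCompl (e : ℕ → X) (S : Set ℕ) : Submodule ℝ X :=
  (Submodule.span ℝ (e '' Sᶜ)).topologicalClosure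

/-- `Y` is tight in the basic sequence `e`. -/
def TightIn (e : ℕ → X) (Y : Type*) [NormedAddCommGroup Y] [NormedSpace ℝ Y] : Prop :=
  ∃ I : ℕ → Finset ℕ, (∀ i j : ℕ, i < j → ∀ a ∈ I i, ∀ b ∈ I j, a < b) ∧
    ∀ A : Set ℕ, A.Infinite → ¬ Embeds Y ↥(spanCompl e (⋃ i ∈ A, (I i : Set ℕ)))

/-- The basis `e` is tight: every infinite-dimensional Banach space is tight in it. -/
def TightBasis (e : ℕ → X) : Prop :=
  ∀ (Y : Type) [NormedAddCommGroup Y] [NormedSpace ℝ Y] [CompleteSpace Y],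
    ¬ FiniteDimensional ℝ Y → TightIn e Y

end Prelude

/-- A block sequence of the basis: nonzero finitely supported vectors with successive
supports (given by their coefficient sequences). -/
def IsBlockSeq (y : ℕ → ℕ →₀ ℝ) : Prop :=
  (∀ n, (y n).support.Nonempty) ∧ ∀ i j : ℕ, i < j → FsuppLt (y i) (y j)

/-- The block subspace `[yₙ]`. -/
def blockSpan {X : Type} [NormedAddCommGroup X] [NormedSpace ℝ X]
    (e : ℕ → X) (y : ℕ → ℕ →₀ ℝ) : Submodule ℝ X :=
  (Submodule.span ℝ (Set.range fun n => vecOf e (y n))).topologicalClosure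

/-- The range of a finitely supported vector: the smallest interval containing its
support. -/
def rangeSet (c : ℕ →₀ ℝ) : Set ℕ :=
  Set.Icc (sInf (↑c.support : Set ℕ)) (sSup (↑c.support : Set ℕ))

/-- The basis `e` is tight by support. -/
def TightBySupport {X : Type} [NormedAddCommGroup X] [NormedSpace ℝ X]
    (e : ℕ → X) : Prop :=
  ∀ y : ℕ → ℕ →₀ ℝ, IsBlockSeq y → ∀ A : Set ℕ, A.Infinite →
    ¬ Embeds ↥(blockSpan e y) ↥(spanCompl e (⋃ k ∈ A, ((y k).support : Set ℕ)))

/-- The basis `e` is tight by range. -/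
def TightByRange {X : Type} [NormedAddCommGroup X] [NormedSpace ℝ X]
    (e : ℕ → X) : Prop :=
  ∀ y : ℕ → ℕ →₀ ℝ, IsBlockSeq y → ∀ A : Set ℕ, A.Infinite →
    ¬ Embeds ↥(blockSpan e y) ↥(spanCompl e (⋃ k ∈ A, rangeSet (y k)))

theorem vecOf_eq_linearCombination {X : Type*} [NormedAddCommGroup X] [NormedSpace ℝ X]
    (e : ℕ → X) (c : ℕ →₀ ℝ) : vecOf e c = Finsupp.linearCombination ℝ e c := rfl

/-- Sequences with equivalent norms on linear combinations have isomorphic closed spans. -/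
theorem nonempty_closedSpan_equiv {ι X : Type*} [NormedAddCommGroup X] [NormedSpace ℝ X]
    [CompleteSpace X] (u v : ι → X) (M₁ M₂ : ℝ)
    (h₁ : ∀ c, ‖Finsupp.linearCombination ℝ v c‖ ≤ M₁ * ‖Finsupp.linearCombination ℝ u c‖)
    (h₂ : ∀ c, ‖Finsupp.linearCombination ℝ u c‖ ≤ M₂ * ‖Finsupp.linearCombination ℝ v c‖) :
    Nonempty (↥(Submodule.span ℝ (Set.range u)).topologicalClosure ≃L[ℝ]
      ↥(Submodule.span ℝ (Set.range v)).topologicalClosure) := by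
  have mem (w : ι → X) (c) : Finsupp.linearCombination ℝ w c ∈
      (Submodule.span ℝ (Set.range w)).topologicalClosure :=
    Submodule.le_topologicalClosure _
      (Finsupp.range_linearCombination (R := ℝ) (v := w) ▸ LinearMap.mem_range_self _ c)
  have dense (w : ι → X) :
      DenseRange ((Finsupp.linearCombination ℝ w).codRestrict _ (mem w)) := by
    intro x
    rw [closure_subtype, ← Set.range_comp]
    have hx : (x : X) ∈ closure (Submodule.span ℝ (Set.range w) : Set X) := x.2
    have hrange : Set.range (Finsupp.linearCombination ℝ w) = Submodule.span ℝ (Set.range w) := by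
      rw [← Finsupp.range_linearCombination, LinearMap.coe_range]
    rw [← hrange] at hx
    exact hx
  have hc (w : ι → X) :
      IsClosed ((Submodule.span ℝ (Set.range w)).topologicalClosure : Set X) :=
    Submodule.isClosed_topologicalClosure _
  have := (hc u).completeSpace_coe
  have := (hc v).completeSpace_coe
  exact ⟨(LinearEquiv.refl ℝ (ι →₀ ℝ)).extend
    ((Finsupp.linearCombination ℝ u).codRestrict _ (mem u))
    ((Finsupp.linearCombination ℝ v).codRestrict _ (mem v))
    (dense u) ⟨M₁, h₁⟩ (dense v) ⟨M₂, h₂⟩⟩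

/-- Coordinate projections are uniformly bounded for an unconditional sequence. -/
theorem norm_vecOf_filter_le {X : Type*} [NormedAddCommGroup X] [NormedSpace ℝ X]
    {e : ℕ → X} {C : ℝ}
    (hC : ∀ (c : ℕ →₀ ℝ) (ε : ℕ → ℝ), (∀ k, ε k = 1 ∨ ε k = -1) →
      ‖∑ k ∈ c.support, (ε k * c k) • e k‖ ≤ C * ‖vecOf e c‖)
    (p : ℕ → Prop) [DecidablePred p] (c : ℕ →₀ ℝ) :
    ‖vecOf e (c.filter p)‖ ≤ ((1 + |C|) / 2) * ‖vecOf e c‖ := by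
  have h := hC c (fun k => if p k then 1 else -1) (fun k => by by_cases hk : p k <;> simp [hk])
  have hsum : (2 : ℝ) • vecOf e (c.filter p) = vecOf e c +
      ∑ k ∈ c.support, ((if p k then (1 : ℝ) else -1) * c k) • e k := by
    have hf : vecOf e (c.filter p) = ∑ k ∈ c.support, (c.filter p) k • e k :=
      Finsupp.sum_of_support_subset _ (by
        rw [Finsupp.support_filter]; exact Finset.filter_subset _ _) _ (by simp)
    rw [hf, vecOf, Finsupp.sum, ← Finset.sum_add_distrib, Finset.smul_sum]
    refine Finset.sum_congr rfl fun k _ => ?_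
    by_cases hk : p k <;> simp [hk, two_smul]
  have hn : 2 * ‖vecOf e (c.filter p)‖ = ‖(2 : ℝ) • vecOf e (c.filter p)‖ := by
    simp [norm_smul]
  have habs : C * ‖vecOf e c‖ ≤ |C| * ‖vecOf e c‖ := by gcongr; exact le_abs_self C
  have htri := norm_add_le (vecOf e c)
    (∑ k ∈ c.support, ((if p k then (1 : ℝ) else -1) * c k) • e k)
  rw [← hsum, ← hn] at htri
  linarith

/-- A linear map from finitely supported sequences into `[eₙ : n ∉ S]` has a nonzero vector
supported in any given infinite set whose image lies in `[eₙ : n ∉ S, n ≥ N]`. -/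
theorem exists_supported_map_mem_tail {X : Type*} [NormedAddCommGroup X] [NormedSpace ℝ X]
    {e : ℕ → X} {S : Set ℕ} (G : (ℕ →₀ ℝ) →ₗ[ℝ] X) (hG : ∀ a, G a ∈ spanCompl e S)
    {D : Set ℕ} (hD : D.Infinite) (N : ℕ) :
    ∃ a : ℕ →₀ ℝ, a ≠ 0 ∧ (a.support : Set ℕ) ⊆ D ∧
      G a ∈ (Submodule.span ℝ (e '' (Sᶜ ∩ Set.Ici N))).topologicalClosure := by
  set Y := (Submodule.span ℝ (e '' (Sᶜ ∩ Set.Ici N))).topologicalClosure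
  have : IsClosed (Y : Set X) := Submodule.isClosed_topologicalClosure _
  let F : Submodule ℝ (X ⧸ Y) := Submodule.span ℝ ((fun n => Y.mkQ (e n)) '' Set.Iio N)
  have : FiniteDimensional ℝ F :=
    FiniteDimensional.span_of_finite ℝ ((Set.finite_Iio N).image _)
  have hFc : IsClosed (F : Set (X ⧸ Y)) := F.closed_of_finiteDimensional
  have hle : spanCompl e S ≤ F.comap Y.mkQ := by
    refine Submodule.topologicalClosure_minimal _ ?_ ?_
    · rw [Submodule.span_le]
      rintro _ ⟨n, hn, rfl⟩
      rcases lt_or_ge n N with h | h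
      · exact Submodule.subset_span ⟨n, h, rfl⟩
      · have : Y.mkQ (e n) = 0 := by
          rw [Submodule.mkQ_apply, Submodule.Quotient.mk_eq_zero]
          exact Submodule.le_topologicalClosure _ (Submodule.subset_span ⟨n, ⟨hn, h⟩, rfl⟩)
        simp only [SetLike.mem_coe, Submodule.mem_comap, this, F.zero_mem]
    · exact hFc.preimage (Submodule.continuous_mkQ Y)
  let H : Finsupp.supported ℝ ℝ D →ₗ[ℝ] F :=
    ((Y.mkQ ∘ₗ G).codRestrict F (fun a => hle (hG a))) ∘ₗ (Finsupp.supported ℝ ℝ D).subtype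
  have hH : ¬ Function.Injective H := by
    intro hinj
    have := Module.Finite.of_injective H hinj
    have : Module.Finite ℝ (D →₀ ℝ) :=
      Module.Finite.equiv (Finsupp.supportedEquivFinsupp (R := ℝ) (M := ℝ) D)
    have := hD.to_subtype
    exact (Module.Finite.finite_basis (Finsupp.basisSingleOne (R := ℝ) (ι := D))).false
  rw [injective_iff_map_eq_zero] at hH
  push Not at hH
  obtain ⟨a, ha, ha0⟩ := hH
  refine ⟨a, by simpa using ha0, a.2, ?_⟩
  have := congrArg Subtype.val ha
  exact (Submodule.Quotient.mk_eq_zero Y).1 this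

/-- Vectors of `[eₙ : n ∈ R]` are approximated by vectors finitely supported in `R`. -/
theorem exists_norm_vecOf_sub_lt {X : Type*} [NormedAddCommGroup X] [NormedSpace ℝ X]
    {e : ℕ → X} {R : Set ℕ} {g : X}
    (hg : g ∈ (Submodule.span ℝ (e '' R)).topologicalClosure) {ε : ℝ} (hε : 0 < ε) :
    ∃ z : ℕ →₀ ℝ, (z.support : Set ℕ) ⊆ R ∧ ‖vecOf e z - g‖ < ε := by
  obtain ⟨v, hv, hd⟩ := Metric.mem_closure_iff.1 hg ε hε
  obtain ⟨z, hz, rfl⟩ := (Finsupp.mem_span_image_iff_linearCombination ℝ).1 hv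
  exact ⟨z, hz, by rwa [dist_comm, dist_eq_norm] at hd⟩

/-- A sequence with infinitely many zero terms has disjointly supported block sequences spanning
the zero space. -/
theorem exists_disjoint_blockSeq_of_infinite_zero {X : Type} [NormedAddCommGroup X]
    [NormedSpace ℝ X] {e : ℕ → X} (h : {n | e n = 0}.Infinite) :
    ∃ x y : ℕ → ℕ →₀ ℝ, IsBlockSeq x ∧ IsBlockSeq y ∧
      Disjoint (⋃ n, ((x n).support : Set ℕ)) (⋃ n, ((y n).support : Set ℕ)) ∧
      Nonempty (↥(blockSpan e x) ≃L[ℝ] ↥(blockSpan e y)) := by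
  have hmono : StrictMono (Nat.nth fun n => e n = 0) := Nat.nth_strictMono h
  have hzero (k : ℕ) : e (Nat.nth (fun n => e n = 0) k) = 0 := Nat.nth_mem_of_infinite h k
  set s := Nat.nth fun n => e n = 0
  have hsupp (k : ℕ) : (Finsupp.single k (1 : ℝ)).support = {k} :=
    Finsupp.support_single _ one_ne_zero
  have hblock (f : ℕ → ℕ) (hf : StrictMono f) :
      IsBlockSeq fun k => Finsupp.single (s (f k)) (1 : ℝ) := by
    refine ⟨fun n => by simp, fun i j hij a ha b hb => ?_⟩
    simp only [hsupp, Finset.mem_singleton] at ha hb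
    subst ha hb
    exact hmono (hf hij)
  have hspan (f : ℕ → ℕ) :
      blockSpan e (fun k => Finsupp.single (s (f k)) (1 : ℝ)) =
        (Submodule.span ℝ {(0 : X)}).topologicalClosure := by
    simp [blockSpan, vecOf, hzero]
  refine ⟨fun k => Finsupp.single (s (2 * k)) 1, fun k => Finsupp.single (s (2 * k + 1)) 1,
    hblock _ fun i j h => by omega, hblock _ fun i j h => by omega, ?_, ?_⟩
  · simp only [hsupp, Set.disjoint_left, Set.mem_iUnion, Finset.coe_singleton,
      Set.mem_singleton_iff]
    rintro _ ⟨i, rfl⟩ ⟨j, hj⟩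
    have := hmono.injective hj
    omega
  · rw [hspan (fun k => 2 * k), hspan (fun k => 2 * k + 1)]
    exact ⟨ContinuousLinearEquiv.refl ℝ _⟩

theorem IsBlockSeq.index_le {y : ℕ → ℕ →₀ ℝ} (hy : IsBlockSeq y) :
    ∀ k, ∀ j ∈ (y k).support, k ≤ j
  | 0, j, _ => Nat.zero_le j
  | k + 1, j, hj => by
    obtain ⟨b, hb⟩ := hy.1 k
    exact (hy.index_le k b hb).trans_lt (hy.2 k (k + 1) k.lt_succ_self b hb j hj)

theorem IsBlockSeq.eq_of_mem {y : ℕ → ℕ →₀ ℝ} (hy : IsBlockSeq y) {i k j : ℕ}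
    (hi : j ∈ (y i).support) (hk : j ∈ (y k).support) : i = k := by
  rcases lt_trichotomy i k with h | h | h
  · exact absurd (hy.2 _ _ h j hi j hk) (lt_irrefl j)
  · exact h
  · exact absurd (hy.2 _ _ h j hk j hi) (lt_irrefl j)

theorem IsBlockSeq.linearCombination_apply {y : ℕ → ℕ →₀ ℝ} (hy : IsBlockSeq y) (a : ℕ →₀ ℝ)
    {k j : ℕ} (hj : j ∈ (y k).support) :
    Finsupp.linearCombination ℝ y a j = a k * y k j := by
  rw [Finsupp.linearCombination_apply, Finsupp.sum, Finsupp.finsetSum_apply,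
    Finset.sum_eq_single k]
  · simp
  · intro i _ hik
    have : y i j = 0 := Finsupp.notMem_support_iff.1 fun h => hik (hy.eq_of_mem h hj)
    simp [this]
  · intro hk
    simp [Finsupp.notMem_support_iff.1 hk]

theorem exists_mem_support_of_mem_support_linearCombination {y : ℕ → ℕ →₀ ℝ} {a : ℕ →₀ ℝ} {j : ℕ}
    (hj : j ∈ (Finsupp.linearCombination ℝ y a).support) :
    ∃ k ∈ a.support, j ∈ (y k).support := by
  by_contra! h
  refine Finsupp.mem_support_iff.1 hj ?_
  rw [Finsupp.linearCombination_apply, Finsupp.sum, Finsupp.finsetSum_apply]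
  refine Finset.sum_eq_zero fun k hk => ?_
  simp [Finsupp.notMem_support_iff.1 (h k hk)]

theorem IsBlockSeq.filter_linearCombination {y : ℕ → ℕ →₀ ℝ} (hy : IsBlockSeq y) (a : ℕ →₀ ℝ)
    (k : ℕ) :
    (Finsupp.linearCombination ℝ y a).filter (fun j => j ∈ (y k).support) = a k • y k := by
  ext j
  by_cases hj : j ∈ (y k).support
  · rw [Finsupp.filter_apply_pos _ _ hj, hy.linearCombination_apply a hj]
    simp
  · rw [Finsupp.filter_apply_neg _ _ hj]
    simp [Finsupp.notMem_support_iff.1 hj]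

theorem vecOf_linearCombination {X : Type*} [NormedAddCommGroup X] [NormedSpace ℝ X]
    (e : ℕ → X) (y : ℕ → ℕ →₀ ℝ) (a : ℕ →₀ ℝ) :
    vecOf e (Finsupp.linearCombination ℝ y a) =
      Finsupp.linearCombination ℝ (fun n => vecOf e (y n)) a := by
  simp only [vecOf_eq_linearCombination]
  rw [Finsupp.apply_linearCombination]
  rfl

/-- A block sequence of an unconditional sequence, indexed where the sequence has no zero terms,
is linearly independent. -/
theorem IsBlockSeq.linearCombination_vecOf_ne_zero {X : Type*} [NormedAddCommGroup X]
    [NormedSpace ℝ X] {e : ℕ → X} {C : ℝ}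
    (hC : ∀ (c : ℕ →₀ ℝ) (ε : ℕ → ℝ), (∀ k, ε k = 1 ∨ ε k = -1) →
      ‖∑ k ∈ c.support, (ε k * c k) • e k‖ ≤ C * ‖vecOf e c‖)
    {n₀ : ℕ} (he : ∀ n ≥ n₀, e n ≠ 0) {y : ℕ → ℕ →₀ ℝ} (hy : IsBlockSeq y) {a : ℕ →₀ ℝ}
    (ha : a ≠ 0) (hsupp : ∀ k ∈ a.support, n₀ ≤ k) :
    Finsupp.linearCombination ℝ (fun n => vecOf e (y n)) a ≠ 0 := by
  obtain ⟨k, hk⟩ := Finsupp.support_nonempty_iff.2 ha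
  obtain ⟨j, hj⟩ := hy.1 k
  intro h0
  rw [← vecOf_linearCombination] at h0
  have hle := norm_vecOf_filter_le hC (· = j) (Finsupp.linearCombination ℝ y a)
  have hfilter : (Finsupp.linearCombination ℝ y a).filter (· = j) =
      Finsupp.single j (a k * y k j) := by
    ext i
    by_cases hij : i = j
    · rw [Finsupp.filter_apply_pos (· = j) _ hij, hij, hy.linearCombination_apply a hj,
        Finsupp.single_eq_same]
    · rw [Finsupp.filter_apply_neg (· = j) _ hij, Finsupp.single_eq_of_ne hij]
  rw [h0, norm_zero, mul_zero, hfilter, vecOf_eq_linearCombination,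
    Finsupp.linearCombination_single, norm_le_zero_iff, smul_eq_zero] at hle
  rcases hle with h | h
  · exact mul_ne_zero (Finsupp.mem_support_iff.1 hk) (Finsupp.mem_support_iff.1 hj) h
  · exact he j ((hsupp k hk).trans (hy.index_le k j hj)) h

/-- Coefficients of a normalized block sequence of an unconditional sequence are bounded. -/
theorem IsBlockSeq.abs_coeff_le {X : Type*} [NormedAddCommGroup X]
    [NormedSpace ℝ X] {e : ℕ → X} {C : ℝ}
    (hC : ∀ (c : ℕ →₀ ℝ) (ε : ℕ → ℝ), (∀ k, ε k = 1 ∨ ε k = -1) →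
      ‖∑ k ∈ c.support, (ε k * c k) • e k‖ ≤ C * ‖vecOf e c‖)
    {w : ℕ → ℕ →₀ ℝ} (hw : IsBlockSeq w) (hnorm : ∀ k, ‖vecOf e (w k)‖ = 1)
    (b : ℕ →₀ ℝ) (k : ℕ) :
    |b k| ≤ (1 + |C|) / 2 * ‖Finsupp.linearCombination ℝ (fun n => vecOf e (w n)) b‖ := by
  have h := norm_vecOf_filter_le hC (fun j => j ∈ (w k).support)
    (Finsupp.linearCombination ℝ w b)
  rw [hw.filter_linearCombination, vecOf_linearCombination, vecOf_eq_linearCombination, map_smul,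
    norm_smul, ← vecOf_eq_linearCombination, hnorm, mul_one, Real.norm_eq_abs] at h
  exact h

/-- Principle of small perturbations: if `u` and `g` are equivalent sequences, the coefficients
with respect to `u` are bounded by `K`, and `v k` is close to `g k`, then `u` and `v` have
isomorphic closed spans. -/
theorem nonempty_closedSpan_equiv_of_perturbation {X : Type*} [NormedAddCommGroup X]
    [NormedSpace ℝ X] [CompleteSpace X] {u g v : ℕ → X} {c M K : ℝ} (hc : 0 < c) (hK : 0 < K)
    (hlow : ∀ b, c * ‖Finsupp.linearCombination ℝ u b‖ ≤ ‖Finsupp.linearCombination ℝ g b‖)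
    (hupp : ∀ b, ‖Finsupp.linearCombination ℝ g b‖ ≤ M * ‖Finsupp.linearCombination ℝ u b‖)
    (hcoeff : ∀ (b : ℕ →₀ ℝ) k, |b k| ≤ K * ‖Finsupp.linearCombination ℝ u b‖)
    (hclose : ∀ k, ‖v k - g k‖ ≤ c / (4 * K) * (1 / 2) ^ k) :
    Nonempty (↥(Submodule.span ℝ (Set.range u)).topologicalClosure ≃L[ℝ]
      ↥(Submodule.span ℝ (Set.range v)).topologicalClosure) := by
  have herr (b : ℕ →₀ ℝ) :
      ‖Finsupp.linearCombination ℝ v b - Finsupp.linearCombination ℝ g b‖ ≤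
        c / 2 * ‖Finsupp.linearCombination ℝ u b‖ := by
    have hgeom : ∑ k ∈ b.support, ((1 : ℝ) / 2) ^ k ≤ 2 := by
      exact (summable_geometric_two.sum_le_tsum _ fun _ _ => by positivity).trans_eq
        tsum_geometric_two
    calc ‖Finsupp.linearCombination ℝ v b - Finsupp.linearCombination ℝ g b‖
        = ‖∑ k ∈ b.support, b k • (v k - g k)‖ := by
          simp only [Finsupp.linearCombination_apply, Finsupp.sum, smul_sub,
            Finset.sum_sub_distrib]
      _ ≤ ∑ k ∈ b.support, K * ‖Finsupp.linearCombination ℝ u b‖ *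
            (c / (4 * K) * (1 / 2) ^ k) := by
          refine norm_sum_le_of_le _ fun k _ => ?_
          rw [norm_smul, Real.norm_eq_abs]
          exact mul_le_mul (hcoeff b k) (hclose k) (norm_nonneg _) (by positivity)
      _ = c / 4 * ‖Finsupp.linearCombination ℝ u b‖ * ∑ k ∈ b.support, ((1 : ℝ) / 2) ^ k := by
          rw [Finset.mul_sum]
          refine Finset.sum_congr rfl fun k _ => ?_
          field_simp
      _ ≤ c / 4 * ‖Finsupp.linearCombination ℝ u b‖ * 2 := by gcongr
      _ = c / 2 * ‖Finsupp.linearCombination ℝ u b‖ := by ring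
  refine nonempty_closedSpan_equiv u v (M + c / 2) (2 / c) (fun b => ?_) fun b => ?_
  · have h := norm_le_norm_add_norm_sub' (Finsupp.linearCombination ℝ v b)
      (Finsupp.linearCombination ℝ g b)
    linarith [herr b, hupp b]
  · have h := norm_le_norm_add_norm_sub (Finsupp.linearCombination ℝ v b)
      (Finsupp.linearCombination ℝ g b)
    have : c / 2 * ‖Finsupp.linearCombination ℝ u b‖ ≤ ‖Finsupp.linearCombination ℝ v b‖ := by
      linarith [herr b, hlow b]
    rw [div_mul_eq_mul_div, le_div_iff₀ hc]
    linarith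

/-- If a block subspace embeds into the complement of infinitely many of its supports, then there
are isomorphic block subspaces with disjoint supports. -/
theorem exists_disjoint_blockSeq_of_embeds {X : Type} [NormedAddCommGroup X]
    [NormedSpace ℝ X] [CompleteSpace X] {e : ℕ → X} {C : ℝ}
    (hC : ∀ (c : ℕ →₀ ℝ) (ε : ℕ → ℝ), (∀ k, ε k = 1 ∨ ε k = -1) →
      ‖∑ k ∈ c.support, (ε k * c k) • e k‖ ≤ C * ‖vecOf e c‖)
    (hfin : {n | e n = 0}.Finite) {y : ℕ → ℕ →₀ ℝ} (hy : IsBlockSeq y) {A : Set ℕ}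
    (hA : A.Infinite)
    (hemb : Embeds ↥(blockSpan e y) ↥(spanCompl e (⋃ k ∈ A, ((y k).support : Set ℕ)))) :
    ∃ w z : ℕ → ℕ →₀ ℝ, IsBlockSeq w ∧ IsBlockSeq z ∧
      Disjoint (⋃ n, ((w n).support : Set ℕ)) (⋃ n, ((z n).support : Set ℕ)) ∧
      Nonempty (↥(blockSpan e w) ≃L[ℝ] ↥(blockSpan e z)) := by
  set S := ⋃ k ∈ A, ((y k).support : Set ℕ)
  obtain ⟨T, c, hc, hT⟩ := hemb
  obtain ⟨n₀, hn₀⟩ : ∃ n₀, ∀ n ≥ n₀, e n ≠ 0 := by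
    obtain ⟨m, hm⟩ := hfin.bddAbove
    exact ⟨m + 1, fun n hn h0 => by have := hm h0; omega⟩
  set K := (1 + |C|) / 2 with hK
  have hKhalf : 1 / 2 ≤ K := by have := abs_nonneg C; linarith
  have hKpos : 0 < K := by linarith
  let L : (ℕ →₀ ℝ) →ₗ[ℝ] X := Finsupp.linearCombination ℝ fun n => vecOf e (y n)
  have hLmem (a) : L a ∈ blockSpan e y :=
    Submodule.le_topologicalClosure _
      (Finsupp.range_linearCombination (R := ℝ) (v := fun n => vecOf e (y n)) ▸
        LinearMap.mem_range_self _ a)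
  let G : (ℕ →₀ ℝ) →ₗ[ℝ] X :=
    (spanCompl e S).subtype ∘ₗ T.toLinearMap ∘ₗ L.codRestrict _ hLmem
  have hGlow (a) : c * ‖L a‖ ≤ ‖G a‖ := hT ⟨L a, hLmem a⟩
  have hGupp (a) : ‖G a‖ ≤ ‖T‖ * ‖L a‖ := T.le_opNorm ⟨L a, hLmem a⟩
  let B : (ℕ →₀ ℝ) →ₗ[ℝ] (ℕ →₀ ℝ) := Finsupp.linearCombination ℝ y
  have hBL (a) : vecOf e (B a) = L a := vecOf_linearCombination e y a
  have step (k N : ℕ) : ∃ (a z : ℕ →₀ ℝ) (N' : ℕ), N ≤ N' ∧ ‖L a‖ = 1 ∧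
      (a.support : Set ℕ) ⊆ A ∧ (∀ j ∈ (B a).support, N ≤ j ∧ j < N') ∧
      (z.support : Set ℕ) ⊆ Sᶜ ∧ (∀ j ∈ z.support, N ≤ j ∧ j < N') ∧
      ‖vecOf e z - G a‖ < c / (4 * K) * (1 / 2) ^ k := by
    have hD : (A ∩ Set.Ici (max N n₀)).Infinite := by
      rw [← Set.sdiff_compl, Set.compl_Ici]
      exact hA.sdiff (Set.finite_Iio _)
    obtain ⟨a, ha0, haD, haG⟩ :=
      exists_supported_map_mem_tail G (fun a => Subtype.property _) hD N
    have hLa : L a ≠ 0 := hy.linearCombination_vecOf_ne_zero hC hn₀ ha0 fun k hk =>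
      (le_max_right N n₀).trans (haD hk).2
    set a' := ‖L a‖⁻¹ • a with ha'
    have ha's : a'.support ⊆ a.support := Finsupp.support_smul
    obtain ⟨z, hzs, hz⟩ := exists_norm_vecOf_sub_lt
      (g := G a') (ε := c / (4 * K) * (1 / 2) ^ k)
      (by rw [ha', map_smul]; exact Submodule.smul_mem _ _ haG) (by positivity)
    refine ⟨a', z, max N ((B a').support.sup id ⊔ z.support.sup id + 1), le_max_left _ _, ?_,
      fun j hj => (haD (ha's hj)).1, fun j hj => ⟨?_, ?_⟩, fun j hj => (hzs hj).1,
      fun j hj => ⟨(hzs hj).2, ?_⟩, hz⟩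
    · rw [ha', map_smul, norm_smul, norm_inv, norm_norm, inv_mul_cancel₀ (norm_ne_zero_iff.2 hLa)]
    · obtain ⟨i, hi, hij⟩ := exists_mem_support_of_mem_support_linearCombination hj
      exact ((le_max_left N n₀).trans (haD (ha's hi)).2).trans (hy.index_le i j hij)
    · have : j ≤ (B a').support.sup id := Finset.le_sup (f := id) hj
      omega
    · have : j ≤ z.support.sup id := Finset.le_sup (f := id) hj
      omega
  choose a z N' hNN' hLa haA hBa hzS hzN hclose using step
  let N : ℕ → ℕ := fun k => Nat.rec 0 (fun k n => N' k n) k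
  have hN : Monotone N := monotone_nat_of_le_succ fun k => hNN' k (N k)
  have hblock (x : ℕ → ℕ →₀ ℝ) (hne : ∀ k, (x k).support.Nonempty)
      (hx : ∀ k, ∀ j ∈ (x k).support, N k ≤ j ∧ j < N (k + 1)) : IsBlockSeq x :=
    ⟨hne, fun i k hik p hp q hq =>
      ((hx i p hp).2.trans_le (hN hik)).trans_le (hx k q hq).1⟩
  have hw : IsBlockSeq fun k => B (a k (N k)) := by
    refine hblock _ (fun k => ?_) fun k => hBa k (N k)
    rw [Finsupp.support_nonempty_iff]
    intro h0
    have h := hLa k (N k)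
    rw [← hBL, h0] at h
    simp [vecOf] at h
  have hz : IsBlockSeq fun k => z k (N k) := by
    refine hblock _ (fun k => ?_) fun k => hzN k (N k)
    rw [Finsupp.support_nonempty_iff]
    intro h0
    have h := hclose k (N k)
    have hlow := hGlow (a k (N k))
    rw [hLa, mul_one] at hlow
    rw [h0, vecOf, Finsupp.sum_zero_index, zero_sub, norm_neg] at h
    have hpow : ((1 : ℝ) / 2) ^ k ≤ 1 := pow_le_one₀ (by norm_num) (by norm_num)
    have hle : c / (4 * K) * (1 / 2) ^ k ≤ c / (4 * K) * 1 := by gcongr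
    have hle' : c / (4 * K) ≤ c / 2 := by gcongr; linarith
    linarith
  refine ⟨_, _, hw, hz, ?_, ?_⟩
  · rw [Set.disjoint_left]
    intro j hj hj'
    obtain ⟨k, hk⟩ := Set.mem_iUnion.1 hj
    obtain ⟨l, hl⟩ := Set.mem_iUnion.1 hj'
    obtain ⟨i, hi, hij⟩ := exists_mem_support_of_mem_support_linearCombination hk
    exact hzS l (N l) hl (Set.mem_biUnion (haA k (N k) hi) hij)
  · have hWL (b : ℕ →₀ ℝ) :
        Finsupp.linearCombination ℝ (fun k => vecOf e (B (a k (N k)))) b =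
          L (Finsupp.linearCombination ℝ (fun k => a k (N k)) b) := by
      simp only [hBL]
      rw [Finsupp.apply_linearCombination]
      rfl
    have hGL (b : ℕ →₀ ℝ) :
        Finsupp.linearCombination ℝ (fun k => G (a k (N k))) b =
          G (Finsupp.linearCombination ℝ (fun k => a k (N k)) b) := by
      rw [Finsupp.apply_linearCombination]
      rfl
    refine nonempty_closedSpan_equiv_of_perturbation (g := fun k => G (a k (N k))) (M := ‖T‖)
      hc hKpos (fun b => ?_) (fun b => ?_)
      (hw.abs_coeff_le hC fun k => by rw [hBL, hLa]) fun k => (hclose k (N k)).le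
    · rw [hWL, hGL]
      exact hGlow _
    · rw [hWL, hGL]
      exact hGupp _

/-- for an unconditional basis, tightness by support is equivalent to no
two disjointly supported block subspaces being isomorphic; in particular if some block
subspace `[xₙ]` embeds into `[eᵢ : i ∉ ⋃ₙ supp xₙ]` then the basis is not tight by
support. -/
theorem stmt13 {X : Type} [NormedAddCommGroup X] [NormedSpace ℝ X] [CompleteSpace X]
    (e : ℕ → X)
    (hbasis : (Submodule.span ℝ (Set.range e)).topologicalClosure = ⊤)
    (hunc : ∃ C : ℝ, ∀ (c : ℕ →₀ ℝ) (ε : ℕ → ℝ), (∀ k, ε k = 1 ∨ ε k = -1) →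
      ‖∑ k ∈ c.support, (ε k * c k) • e k‖ ≤ C * ‖vecOf e c‖) :
    (TightBySupport e ↔
      ∀ x y : ℕ → ℕ →₀ ℝ, IsBlockSeq x → IsBlockSeq y →
        Disjoint (⋃ n, ((x n).support : Set ℕ)) (⋃ n, ((y n).support : Set ℕ)) →
        ¬ Nonempty (↥(blockSpan e x) ≃L[ℝ] ↥(blockSpan e y))) ∧
    (∀ x : ℕ → ℕ →₀ ℝ, IsBlockSeq x →
      Embeds ↥(blockSpan e x) ↥(spanCompl e (⋃ n, ((x n).support : Set ℕ))) →
      ¬ TightBySupport e) := by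
  obtain ⟨C, hC⟩ := hunc
  refine ⟨⟨?_, ?_⟩, ?_⟩
  · rintro htight x y hx - hdisj ⟨T⟩
    refine htight x hx Set.univ Set.infinite_univ ?_
    have hle : blockSpan e y ≤ spanCompl e (⋃ k ∈ Set.univ, ((x k).support : Set ℕ)) := by
      refine Submodule.topologicalClosure_mono (Submodule.span_le.2 ?_)
      rintro _ ⟨n, rfl⟩
      refine Submodule.sum_mem _ fun j hj => Submodule.smul_mem _ _ (Submodule.subset_span ?_)
      refine ⟨j, fun hj' => ?_, rfl⟩
      simp only [Set.biUnion_univ] at hj'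
      exact Set.disjoint_left.1 hdisj hj' (Set.mem_iUnion.2 ⟨n, hj⟩)
    let ι : ↥(blockSpan e y) →L[ℝ] ↥(spanCompl e (⋃ k ∈ Set.univ, ((x k).support : Set ℕ))) :=
      (blockSpan e y).subtypeL.codRestrict _ fun v => hle v.2
    let T' : ↥(blockSpan e y) →L[ℝ] ↥(blockSpan e x) := T.symm
    refine ⟨ι.comp (T : ↥(blockSpan e x) →L[ℝ] ↥(blockSpan e y)), (‖T'‖ + 1)⁻¹,
      by positivity, fun v => ?_⟩
    rw [inv_mul_le_iff₀ (by positivity)]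
    have h := T'.le_opNorm (T v)
    change ‖T.symm (T v)‖ ≤ _ at h
    rw [T.symm_apply_apply] at h
    change ‖v‖ ≤ (‖T'‖ + 1) * ‖T v‖
    linarith [norm_nonneg (T v)]
  · intro h y hy A hA hemb
    by_cases hfin : {n | e n = 0}.Finite
    · obtain ⟨w, z, hw, hz, hdisj, hiso⟩ := exists_disjoint_blockSeq_of_embeds hC hfin hy hA hemb
      exact h w z hw hz hdisj hiso
    · obtain ⟨w, z, hw, hz, hdisj, hiso⟩ := exists_disjoint_blockSeq_of_infinite_zero hfin
      exact h w z hw hz hdisj hiso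
  · intro x hx hemb htight
    refine htight x hx Set.univ Set.infinite_univ ?_
    rwa [Set.biUnion_univ]
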